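/- For all integers p ≥ q ≥ 1 and all real numbers x_q,…,x_p, one has the closed formula w_{p,q}(x_q,…,x_p) = (2/3)^{p−q+1} + (1/3)·Σ_{ℓ=q}^{p} (2/3)^{ℓ−q} · y_{p,ℓ}(x_ℓ,…,x_p). -/

import Mathlib

open Finset

/-- The 2×2 matrix `R(x)` with rows `(1−x, x)` and `(x, 1−x)`. -/
noncomputable def Rm (x : ℝ) : Matrix (Fin 2) (Fin 2) ℝ := !![1 - x, x; x, 1 - x]

/-- The 2×2 matrix `T` with rows `(1, −1)` and `(0, 1)`. -/
noncomputable def Tm : Matrix (Fin 2) (Fin 2) ℝ := !![1, -1; 0, 1]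

/-- Auxiliary product: `Maux x q n = R(x_{q+n})·T ⋯ R(x_q)·T`. -/
noncomputable def Maux (x : ℕ → ℝ) (q : ℕ) : ℕ → Matrix (Fin 2) (Fin 2) ℝ
  | 0 => Rm (x q) * Tm
  | n + 1 => Rm (x (q + n + 1)) * Tm * Maux x q n

/-- `Mpq x p q = M_{p,q}(x_q,…,x_p) = R(x_p)·T·R(x_{p−1})·T ⋯ R(x_q)·T` (for `q ≤ p`). -/
noncomputable def Mpq (x : ℕ → ℝ) (p q : ℕ) : Matrix (Fin 2) (Fin 2) ℝ := Maux x q (p - q)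

/-- `α_{p,q} = (M_{p,q})₂₂`. -/
noncomputable def alphaPQ (x : ℕ → ℝ) (p q : ℕ) : ℝ := Mpq x p q 1 1

/-- `β_{p,q} = (M_{p,q})₂₁`. -/
noncomputable def betaPQ (x : ℕ → ℝ) (p q : ℕ) : ℝ := Mpq x p q 1 0

/-- `γ_{p,q} = (M_{p,q})₁₂`. -/
noncomputable def gammaPQ (x : ℕ → ℝ) (p q : ℕ) : ℝ := Mpq x p q 0 1

/-- `δ_{p,q} = (M_{p,q})₁₁`. -/
noncomputable def deltaPQ (x : ℕ → ℝ) (p q : ℕ) : ℝ := Mpq x p q 0 0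

/-- `y_{p,q} = α_{p,q} − β_{p,q}`. -/
noncomputable def yPQ (x : ℕ → ℝ) (p q : ℕ) : ℝ := alphaPQ x p q - betaPQ x p q

/-- `w_{p,q} = α_{p,q} + β_{p,q}`. -/
noncomputable def wPQ (x : ℕ → ℝ) (p q : ℕ) : ℝ := alphaPQ x p q + betaPQ x p q

/-- `θ_s^k(x_s,…,x_{k−1}; a) = a_s + Σ_{j=s}^{k−1} a_{j+1}·y_{j,s}`
(for `k = s` this is just `a_s`). -/
noncomputable def theta (x a : ℕ → ℝ) (k s : ℕ) : ℝ :=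
  a s + ∑ j ∈ Finset.Icc s (k - 1), a (j + 1) * yPQ x j s

/-- Peeling off the rightmost factor of the product. -/
theorem Maux_succ_right (x : ℕ → ℝ) (q n : ℕ) :
    Maux x q (n + 1) = Maux x (q + 1) n * (Rm (x q) * Tm) := by
  induction n with
  | zero => rfl
  | succ n ih =>
    rw [Maux, ih, Maux, ← Matrix.mul_assoc, show q + (n + 1) + 1 = q + 1 + n + 1 by lia]

theorem Mpq_eq_mul (x : ℕ → ℝ) {p q : ℕ} (h : q < p) :
    Mpq x p q = Mpq x p (q + 1) * (Rm (x q) * Tm) := by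
  rw [Mpq, Mpq, ← Maux_succ_right, show p - (q + 1) + 1 = p - q by lia]

theorem wPQ_self (x : ℕ → ℝ) (p : ℕ) : wPQ x p p = 2 / 3 + 1 / 3 * yPQ x p p := by
  simp [wPQ, yPQ, alphaPQ, betaPQ, Mpq, Maux, Rm, Tm]
  ring

theorem wPQ_eq_of_lt (x : ℕ → ℝ) {p q : ℕ} (h : q < p) :
    wPQ x p q = 2 / 3 * wPQ x p (q + 1) + 1 / 3 * yPQ x p q := by
  simp only [wPQ, yPQ, alphaPQ, betaPQ, Mpq_eq_mul x h]
  simp [Rm, Tm, Matrix.mul_apply, Fin.sum_univ_two]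
  ring

/-- Closed formula: `w_{p,q} = (2/3)^{p−q+1} + (1/3) Σ_{ℓ=q}^p (2/3)^{ℓ−q} y_{p,ℓ}`. -/
theorem stmt8 (p q : ℕ) (hq : 1 ≤ q) (hpq : q ≤ p) (x : ℕ → ℝ) :
    wPQ x p q = (2 / 3 : ℝ) ^ (p - q + 1)
      + (1 / 3) * ∑ l ∈ Finset.Icc q p, (2 / 3 : ℝ) ^ (l - q) * yPQ x p l := by
  clear hq
  induction hpq using Nat.decreasingInduction with
  | self => simp [wPQ_self]
  | of_succ q h ih =>
    have hsum : ∑ l ∈ Finset.Icc (q + 1) p, (2 / 3 : ℝ) ^ (l - q) * yPQ x p l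
        = 2 / 3 * ∑ l ∈ Finset.Icc (q + 1) p, (2 / 3 : ℝ) ^ (l - (q + 1)) * yPQ x p l := by
      rw [Finset.mul_sum]
      refine Finset.sum_congr rfl fun l hl => ?_
      have hql := (Finset.mem_Icc.mp hl).1
      rw [show l - q = l - (q + 1) + 1 by lia, pow_succ]
      ring
    rw [wPQ_eq_of_lt x h, ih, ← Finset.insert_Icc_add_one_left_eq_Icc (Nat.le_of_lt h),
      Finset.sum_insert (by simp), hsum, show p - q + 1 = p - (q + 1) + 1 + 1 by lia,
      Nat.sub_self, pow_zero, pow_succ _ (p - (q + 1) + 1)]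
    ring
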